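/- Let H₁ and H₂ be finite-dimensional complex vector spaces, each carrying a complex mixed Hodge structure, with filtrations F_•, F̄_•, W_•. Let T : H₁ → H₂ be a complex-linear map that preserves all three filtrations: T(F_p H₁) ⊆ F_p H₂, T(F̄_q H₁) ⊆ F̄_q H₂, and T(W_k H₁) ⊆ W_k H₂ for all integers p, q, k. Then T preserves all three filtrations strictly: T(F_p H₁) = T(H₁) ∩ F_p H₂, T(F̄_q H₁) = T(H₁) ∩ F̄_q H₂, and T(W_k H₁) = T(H₁) ∩ W_k H₂ for all integers p, q, k. -/

import Mathlib

/-!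
Complex mixed Hodge structures.  A complex mixed Hodge structure on a finite-dimensional
complex vector space `H` consists of three increasing filtrations `F`, `F̄`, `W` by
complex subspaces, with `F` and `F̄` exhaustive, `W` finite, such that for each `k` the
quotient `gr^W_k H = W_k H / W_{k-1} H`, with the induced filtrations, carries a complex
Hodge structure of weight `k`.
-/

/-- The graded piece `gr^W_k H = W_k H / W_{k-1} H` of an increasing filtration `W`. -/
abbrev GrW {H : Type*} [AddCommGroup H] [Module ℂ H]
    (W : ℤ → Submodule ℂ H) (k : ℤ) : Type _ :=
  ↥(W k) ⧸ (W (k - 1)).comap (W k).subtype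

/-- The filtration induced on `gr^W_k H` by a filtration `F` of `H`:
the image of `F_p H ∩ W_k H` in `W_k H / W_{k-1} H`. -/
def inducedFil {H : Type*} [AddCommGroup H] [Module ℂ H]
    (F W : ℤ → Submodule ℂ H) (k p : ℤ) : Submodule ℂ (GrW W k) :=
  ((F p).comap (W k).subtype).map ((W (k - 1)).comap (W k).subtype).mkQ

/-- A complex mixed Hodge structure on `H`: three increasing filtrations `F`, `F̄`, `W`,
with `F`, `F̄` exhaustive and `W` finite, such that each `gr^W_k H`, with the induced
filtrations, carries a complex Hodge structure of weight `k`; the latter means that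
`gr^W_k H` has a direct sum decomposition `⊕_{p+q=k} G^{p,q}` (encoded by
`G : ℤ → Submodule ℂ (GrW W k)`, `G p = G^{p,k-p}`) with
`F_p(gr^W_k H) = ⊕_{r ≥ -p} G^{r,k-r}` and `F̄_q(gr^W_k H) = ⊕_{s ≥ -q} G^{k-s,s}`. -/
structure IsCMHS {H : Type*} [AddCommGroup H] [Module ℂ H]
    (F Fbar W : ℤ → Submodule ℂ H) : Prop where
  monoF : Monotone F
  monoFbar : Monotone Fbar
  monoW : Monotone W
  F_bot : ∃ a : ℤ, F a = ⊥
  F_top : ∃ b : ℤ, F b = ⊤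
  Fbar_bot : ∃ a : ℤ, Fbar a = ⊥
  Fbar_top : ∃ b : ℤ, Fbar b = ⊤
  W_bot : ∃ a : ℤ, W a = ⊥
  W_top : ∃ b : ℤ, W b = ⊤
  hodge : ∀ k : ℤ, ∃ G : ℤ → Submodule ℂ (GrW W k),
    DirectSum.IsInternal G ∧
    (∀ p : ℤ, inducedFil F W k p = ⨆ r ≥ -p, G r) ∧
    (∀ q : ℤ, inducedFil Fbar W k q = ⨆ s ≥ -q, G (k - s))

namespace IsCMHS

section Splitting

variable {H : Type*} [AddCommGroup H] [Module ℂ H] {F Fbar W : ℤ → Submodule ℂ H}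

/-- Exchanging `F` and `F̄` in a complex mixed Hodge structure. -/
lemma swap (h : IsCMHS F Fbar W) : IsCMHS Fbar F W where
  monoF := h.monoFbar
  monoFbar := h.monoF
  monoW := h.monoW
  F_bot := h.Fbar_bot
  F_top := h.Fbar_top
  Fbar_bot := h.F_bot
  Fbar_top := h.F_top
  W_bot := h.W_bot
  W_top := h.W_top
  hodge k := by
    obtain ⟨G, hG, hGF, hGFbar⟩ := h.hodge k
    refine ⟨fun r => G (k - r), ?_, hGFbar, fun p => by simpa using hGF p⟩
    rw [DirectSum.isInternal_submodule_iff_iSupIndep_and_iSup_eq_top] at hG ⊢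
    refine ⟨hG.1.comp (Equiv.subLeft k).injective, ?_⟩
    rw [← hG.2]
    exact (Equiv.subLeft k).iSup_comp (g := G)

/-- On `gr^W_k H` the subspaces `F_p` and `F̄_q` with `p + q + k = -1` are complementary. -/
lemma isCompl_inducedFil (h : IsCMHS F Fbar W) (p k : ℤ) :
    IsCompl (inducedFil F W k p) (inducedFil Fbar W k (-p - 1 - k)) := by
  obtain ⟨G, hG, hGF, hGFbar⟩ := h.hodge k
  rw [DirectSum.isInternal_submodule_iff_iSupIndep_and_iSup_eq_top] at hG
  have hbar : inducedFil Fbar W k (-p - 1 - k) = ⨆ r < -p, G r := by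
    rw [hGFbar]
    refine le_antisymm (iSup₂_le fun s hs => ?_) (iSup₂_le fun r hr => ?_)
    · exact le_iSup₂_of_le (k - s) (by omega) le_rfl
    · exact le_iSup₂_of_le (k - r) (by omega) (by simp)
  rw [hbar, hGF]
  refine ⟨hG.1.disjoint_biSup_biSup (s := {r | r ≥ -p}) (t := {r | r < -p}) ?_, ?_⟩
  · exact Set.disjoint_left.2 fun r (hr : -p ≤ r) (hr' : r < -p) => not_lt.2 hr hr'
  · rw [codisjoint_iff, eq_top_iff, ← hG.2]
    refine iSup_le fun r => ?_
    rcases le_or_gt (-p) r with hr | hr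
    · exact le_sup_of_le_left (le_iSup₂_of_le r hr le_rfl)
    · exact le_sup_of_le_right (le_iSup₂_of_le r hr le_rfl)

lemma mem_W_pred_of_sub_mem (h : IsCMHS F Fbar W) {p k : ℤ} {a b : H}
    (ha : a ∈ F p) (haW : a ∈ W k) (hb : b ∈ Fbar (-p - 1 - k)) (hbW : b ∈ W k)
    (hab : a - b ∈ W (k - 1)) : a ∈ W (k - 1) := by
  set N := (W (k - 1)).comap (W k).subtype
  have h1 : N.mkQ ⟨a, haW⟩ ∈ inducedFil F W k p := Submodule.mem_map_of_mem ha
  have h2 : N.mkQ ⟨b, hbW⟩ ∈ inducedFil Fbar W k (-p - 1 - k) := Submodule.mem_map_of_mem hb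
  have h3 : N.mkQ ⟨a, haW⟩ = N.mkQ ⟨b, hbW⟩ := (Submodule.Quotient.eq N).2 hab
  have h4 : N.mkQ ⟨a, haW⟩ = 0 :=
    Submodule.disjoint_def.1 (h.isCompl_inducedFil p k).disjoint _ h1 (h3 ▸ h2)
  exact (Submodule.Quotient.mk_eq_zero N).1 h4

lemma exists_sub_mem_W_pred (h : IsCMHS F Fbar W) (p : ℤ) {k : ℤ} {x : H} (hx : x ∈ W k) :
    ∃ a ∈ F p ⊓ W k, ∃ b ∈ Fbar (-p - 1 - k) ⊓ W k, x - (a + b) ∈ W (k - 1) := by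
  set N := (W (k - 1)).comap (W k).subtype
  have hmem : N.mkQ ⟨x, hx⟩ ∈ inducedFil F W k p ⊔ inducedFil Fbar W k (-p - 1 - k) := by
    rw [(h.isCompl_inducedFil p k).sup_eq_top]
    trivial
  obtain ⟨_, ⟨a, ha, rfl⟩, _, ⟨b, hb, rfl⟩, hab⟩ := Submodule.mem_sup.1 hmem
  rw [← map_add] at hab
  exact ⟨a, ⟨ha, a.2⟩, b, ⟨hb, b.2⟩, (Submodule.Quotient.eq N).1 hab.symm⟩

/-- The sum of the subspaces `F̄_{-p-1-i} ∩ W_i` for `i ≤ l`: a functorial complement of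
`F_p ∩ W_l` in `W_l`. -/
def oppositeFil (Fbar W : ℤ → Submodule ℂ H) (p l : ℤ) : Submodule ℂ H :=
  ⨆ i ≤ l, Fbar (-p - 1 - i) ⊓ W i

lemma le_oppositeFil (Fbar W : ℤ → Submodule ℂ H) (p l : ℤ) :
    Fbar (-p - 1 - l) ⊓ W l ≤ oppositeFil Fbar W p l :=
  le_iSup₂_of_le (f := fun i (_ : i ≤ l) => Fbar (-p - 1 - i) ⊓ W i) l le_rfl le_rfl

lemma oppositeFil_mono (Fbar W : ℤ → Submodule ℂ H) (p : ℤ) :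
    Monotone (oppositeFil Fbar W p) := fun _ _ hlm =>
  iSup₂_le fun i hi => le_iSup₂_of_le (f := fun i _ => Fbar (-p - 1 - i) ⊓ W i)
    i (hi.trans hlm) le_rfl

lemma exists_add_of_mem_oppositeFil {p l : ℤ} {x : H} (hx : x ∈ oppositeFil Fbar W p l) :
    ∃ b ∈ Fbar (-p - 1 - l) ⊓ W l, ∃ u ∈ oppositeFil Fbar W p (l - 1), b + u = x := by
  refine Submodule.mem_sup.1 ((iSup₂_le fun i hi => ?_ :
    oppositeFil Fbar W p l ≤ _) hx)
  rcases hi.eq_or_lt with rfl | hi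
  · exact le_sup_left
  · exact le_sup_of_le_right (le_iSup₂_of_le (f := fun i _ => Fbar (-p - 1 - i) ⊓ W i)
      i (by omega) le_rfl)

lemma oppositeFil_le_W (h : IsCMHS F Fbar W) (p l : ℤ) : oppositeFil Fbar W p l ≤ W l :=
  iSup₂_le fun _ hi => inf_le_right.trans (h.monoW hi)

lemma mem_oppositeFil_pred (h : IsCMHS F Fbar W) {p l : ℤ} {b : H}
    (hb : b ∈ Fbar (-p - 1 - l)) (hbW : b ∈ W (l - 1)) :
    b ∈ oppositeFil Fbar W p (l - 1) :=
  le_oppositeFil Fbar W p (l - 1) ⟨h.monoFbar (by omega) hb, hbW⟩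

lemma weight_induction (h : IsCMHS F Fbar W) {P : ℤ → Prop}
    (bot : ∀ l, W l = ⊥ → P l) (step : ∀ l, P (l - 1) → P l) (l : ℤ) : P l := by
  obtain ⟨a, ha⟩ := h.W_bot
  rcases le_total l a with hl | hl
  · exact bot l (eq_bot_iff.2 (ha ▸ h.monoW hl))
  · induction l, hl using Int.leInduction with
    | base => exact bot a ha
    | succ n _ ih => exact step (n + 1) (by simpa using ih)

lemma exists_add_of_mem_W (h : IsCMHS F Fbar W) (p l : ℤ) :
    ∀ x ∈ W l, ∃ a ∈ F p ⊓ W l, ∃ u ∈ oppositeFil Fbar W p l, a + u = x := by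
  refine h.weight_induction (P := fun l => ∀ x ∈ W l, ∃ a ∈ F p ⊓ W l,
    ∃ u ∈ oppositeFil Fbar W p l, a + u = x) (fun l hl x hx => ?_) (fun l ih x hx => ?_) l
  · rw [hl, Submodule.mem_bot] at hx
    exact ⟨0, zero_mem _, 0, zero_mem _, by simp [hx]⟩
  · obtain ⟨a, ha, b, hb, hab⟩ := h.exists_sub_mem_W_pred p hx
    obtain ⟨a', ha', u, hu, hau⟩ := ih _ hab
    refine ⟨a + a', add_mem ha ⟨ha'.1, h.monoW (by omega) ha'.2⟩, b + u,
      add_mem (le_oppositeFil _ _ _ _ hb) (oppositeFil_mono _ _ _ (by omega) hu), ?_⟩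
    rw [add_add_add_comm, hau]
    abel

lemma eq_zero_of_mem_oppositeFil (h : IsCMHS F Fbar W) (p l : ℤ) :
    ∀ x ∈ F p, x ∈ oppositeFil Fbar W p l → x = 0 := by
  refine h.weight_induction (P := fun l => ∀ x ∈ F p, x ∈ oppositeFil Fbar W p l → x = 0)
    (fun l hl x _ hx => ?_) (fun l ih x hxF hx => ?_) l
  · simpa [hl] using h.oppositeFil_le_W p l hx
  · have hxW := h.oppositeFil_le_W p l hx
    obtain ⟨b, hb, u, hu, rfl⟩ := exists_add_of_mem_oppositeFil hx
    have huW := h.oppositeFil_le_W p _ hu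
    have hW := h.mem_W_pred_of_sub_mem hxF hxW hb.1 hb.2 (by simpa using huW)
    exact ih _ hxF (add_mem (h.mem_oppositeFil_pred hb.1 ((add_mem_cancel_right huW).1 hW)) hu)

lemma mem_W_of_add_mem_W (h : IsCMHS F Fbar W) {p l m : ℤ} (hlm : l ≤ m) {a u : H}
    (ha : a ∈ F p) (hu : u ∈ oppositeFil Fbar W p m) (hau : a + u ∈ W l) : a ∈ W l := by
  obtain ⟨a', ha', u', hu', heq⟩ := h.exists_add_of_mem_W p l _ hau
  have hsub : a - a' = u' - u := by
    rw [sub_eq_sub_iff_add_eq_add, add_comm u', heq]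
  have hz : a - a' = 0 := h.eq_zero_of_mem_oppositeFil p m _ (sub_mem ha ha'.1)
    (hsub ▸ sub_mem (oppositeFil_mono _ _ _ hlm hu') hu)
  rw [sub_eq_zero.1 hz]
  exact ha'.2

end Splitting

section Morphism

variable {H₁ H₂ : Type*} [AddCommGroup H₁] [Module ℂ H₁] [AddCommGroup H₂] [Module ℂ H₂]
  {F₁ Fbar₁ W₁ : ℤ → Submodule ℂ H₁} {F₂ Fbar₂ W₂ : ℤ → Submodule ℂ H₂} {T : H₁ →ₗ[ℂ] H₂}

lemma map_oppositeFil_le (hFbar : ∀ q, (Fbar₁ q).map T ≤ Fbar₂ q)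
    (hW : ∀ k, (W₁ k).map T ≤ W₂ k) (p l : ℤ) :
    (oppositeFil Fbar₁ W₁ p l).map T ≤ oppositeFil Fbar₂ W₂ p l := by
  simp only [oppositeFil, Submodule.map_iSup]
  exact iSup₂_mono fun i _ =>
    (Submodule.map_inf_le T).trans (inf_le_inf (hFbar _) (hW i))

/-- Morphisms of complex mixed Hodge structures are strict with respect to `F`. -/
lemma map_F_eq (h₁ : IsCMHS F₁ Fbar₁ W₁) (h₂ : IsCMHS F₂ Fbar₂ W₂)
    (hF : ∀ p, (F₁ p).map T ≤ F₂ p) (hFbar : ∀ q, (Fbar₁ q).map T ≤ Fbar₂ q)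
    (hW : ∀ k, (W₁ k).map T ≤ W₂ k) (p : ℤ) :
    (F₁ p).map T = LinearMap.range T ⊓ F₂ p := by
  refine le_antisymm (le_inf LinearMap.map_le_range (hF p)) ?_
  rintro _ ⟨⟨y, rfl⟩, hy⟩
  obtain ⟨t, ht⟩ := h₁.W_top
  obtain ⟨a, ha, u, hu, rfl⟩ := h₁.exists_add_of_mem_W p t y (ht ▸ Submodule.mem_top)
  have hTa : T a ∈ F₂ p := hF p (Submodule.mem_map_of_mem ha.1)
  have hTu : T u = 0 := h₂.eq_zero_of_mem_oppositeFil p t _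
    ((add_mem_cancel_left hTa).1 (by simpa using hy))
    (map_oppositeFil_le hFbar hW p t (Submodule.mem_map_of_mem hu))
  exact ⟨a, ha.1, by simp [hTu]⟩

lemma exists_mem_W_pred (h₁ : IsCMHS F₁ Fbar₁ W₁) (h₂ : IsCMHS F₂ Fbar₂ W₂)
    (hF : ∀ p, (F₁ p).map T ≤ F₂ p) (hFbar : ∀ q, (Fbar₁ q).map T ≤ Fbar₂ q)
    (hW : ∀ k, (W₁ k).map T ≤ W₂ k) (m p : ℤ) :
    ∀ y ∈ F₁ p ⊓ W₁ m, T y ∈ W₂ (m - 1) → ∃ a ∈ W₁ (m - 1), T a = T y := by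
  obtain ⟨c, hc⟩ := h₁.F_bot
  have base : ∀ p ≤ c, ∀ y ∈ F₁ p ⊓ W₁ m, T y ∈ W₂ (m - 1) →
      ∃ a ∈ W₁ (m - 1), T a = T y := fun p hp y hy _ => by
    have hy0 : y = 0 := by simpa [hc] using h₁.monoF hp hy.1
    exact ⟨0, zero_mem _, by simp [hy0]⟩
  rcases le_total p c with hp | hp
  · exact base p hp
  induction p, hp using Int.leInduction with
  | base => exact base c le_rfl
  | succ p _ ih =>
    intro y hy hTy
    obtain ⟨a, ha, u, hu, rfl⟩ := h₁.exists_add_of_mem_W p m y hy.2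
    have hTuo := map_oppositeFil_le hFbar hW p m (Submodule.mem_map_of_mem hu)
    have hTa : T a ∈ W₂ (m - 1) := h₂.mem_W_of_add_mem_W (p := p) (m := m) (by omega)
      (hF p (Submodule.mem_map_of_mem ha.1)) hTuo (by simpa using hTy)
    have hTu : T u ∈ W₂ (m - 1) := (add_mem_cancel_left hTa).1 (by simpa using hTy)
    obtain ⟨a', ha', haa'⟩ := ih a ha hTa
    have huF : u ∈ F₁ (p + 1) :=
      (add_mem_cancel_left (h₁.monoF (by omega) ha.1)).1 hy.1
    obtain ⟨b, hb, w, hw, rfl⟩ := exists_add_of_mem_oppositeFil hu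
    obtain ⟨c', hc', v, hv, rfl⟩ :=
      h₁.exists_add_of_mem_W (p + 1) (m - 1) w (h₁.oppositeFil_le_W p _ hw)
    have hTc : T c' ∈ W₂ (m - 1) := hW _ (Submodule.mem_map_of_mem hc'.2)
    have hTvo := map_oppositeFil_le hFbar hW (p + 1) (m - 1) (Submodule.mem_map_of_mem hv)
    have hTv := h₂.oppositeFil_le_W _ _ hTvo
    have hTb : T b ∈ W₂ (m - 1) := by
      rw [map_add, map_add] at hTu
      exact (add_mem_cancel_right (add_mem hTc hTv)).1 hTu
    have hTbo : T b ∈ oppositeFil Fbar₂ W₂ (p + 1) (m - 1) := le_oppositeFil _ _ _ _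
      ⟨h₂.monoFbar (by omega) (hFbar _ (Submodule.mem_map_of_mem hb.1)), hTb⟩
    have hbv : b + v ∈ F₁ (p + 1) := by
      rw [add_left_comm] at huF
      exact (add_mem_cancel_left hc'.1).1 huF
    have hz : T (b + v) = 0 := h₂.eq_zero_of_mem_oppositeFil (p + 1) (m - 1) _
      (hF _ (Submodule.mem_map_of_mem hbv)) (by rw [map_add]; exact add_mem hTbo hTvo)
    refine ⟨a' + c', add_mem ha' hc'.2, ?_⟩
    rw [map_add, haa', map_add T a, add_left_comm b, map_add T c', hz, add_zero]

/-- Morphisms of complex mixed Hodge structures are strict with respect to `W`. -/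
lemma map_W_eq (h₁ : IsCMHS F₁ Fbar₁ W₁) (h₂ : IsCMHS F₂ Fbar₂ W₂)
    (hF : ∀ p, (F₁ p).map T ≤ F₂ p) (hFbar : ∀ q, (Fbar₁ q).map T ≤ Fbar₂ q)
    (hW : ∀ k, (W₁ k).map T ≤ W₂ k) (k : ℤ) :
    (W₁ k).map T = LinearMap.range T ⊓ W₂ k := by
  refine le_antisymm (le_inf LinearMap.map_le_range (hW k)) ?_
  obtain ⟨c, hc⟩ := h₁.F_top
  have key : ∀ m ≥ k, ∀ y ∈ W₁ m, T y ∈ W₂ k → T y ∈ (W₁ k).map T := by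
    intro m hm
    induction m, hm using Int.leInduction with
    | base => exact fun y hy _ => Submodule.mem_map_of_mem hy
    | succ m hm ih =>
      intro y hy hTy
      obtain ⟨a, ha, hay⟩ := exists_mem_W_pred h₁ h₂ hF hFbar hW (m + 1) c y
        ⟨hc ▸ Submodule.mem_top, hy⟩ (h₂.monoW (by omega) hTy)
      rw [← hay] at hTy ⊢
      exact ih a (by simpa using ha) hTy
  rintro _ ⟨⟨y, rfl⟩, hy⟩
  obtain ⟨t, ht⟩ := h₁.W_top
  exact key (max k t) (le_max_left _ _) y
    (h₁.monoW (le_max_right k t) (ht ▸ Submodule.mem_top)) hy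

end Morphism

end IsCMHS

/-- A linear map between complex mixed Hodge structures which preserves all three
filtrations preserves them strictly:
`T(F_p H₁) = T(H₁) ∩ F_p H₂`, `T(F̄_q H₁) = T(H₁) ∩ F̄_q H₂`, and
`T(W_k H₁) = T(H₁) ∩ W_k H₂`. -/
theorem cmhs_morphisms_are_strict
    {H₁ H₂ : Type*} [AddCommGroup H₁] [Module ℂ H₁] [FiniteDimensional ℂ H₁]
    [AddCommGroup H₂] [Module ℂ H₂] [FiniteDimensional ℂ H₂]
    (F₁ Fbar₁ W₁ : ℤ → Submodule ℂ H₁) (F₂ Fbar₂ W₂ : ℤ → Submodule ℂ H₂)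
    (h₁ : IsCMHS F₁ Fbar₁ W₁) (h₂ : IsCMHS F₂ Fbar₂ W₂)
    (T : H₁ →ₗ[ℂ] H₂)
    (hF : ∀ p : ℤ, (F₁ p).map T ≤ F₂ p)
    (hFbar : ∀ q : ℤ, (Fbar₁ q).map T ≤ Fbar₂ q)
    (hW : ∀ k : ℤ, (W₁ k).map T ≤ W₂ k) :
    (∀ p : ℤ, (F₁ p).map T = LinearMap.range T ⊓ F₂ p) ∧
    (∀ q : ℤ, (Fbar₁ q).map T = LinearMap.range T ⊓ Fbar₂ q) ∧
    (∀ k : ℤ, (W₁ k).map T = LinearMap.range T ⊓ W₂ k) := by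
  exact ⟨h₁.map_F_eq h₂ hF hFbar hW, h₁.swap.map_F_eq h₂.swap hFbar hF hW,
    h₁.map_W_eq h₂ hF hFbar hW⟩
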